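/- Let P be the logit dynamics transition matrix of an n-player game at rationality level β ≥ 0, on profile space S, and suppose P is reversible with respect to a probability distribution π on S with π(x) > 0 for all x. Let L ⊆ S be nonempty and let P′ be a square real matrix indexed by S such that: P′(x,y) = P(x,y) whenever x, y ∈ L and x ≠ y; P′(x,x) ≥ P(x,x) for every x ∈ L; and P′(x,y) = 0 whenever x ∉ L or y ∉ L (in particular P′(x,x) = 0 for x ∉ L). Then every real eigenvalue of P′ is nonnegative: every μ ∈ spectrum ℝ P′ satisfies μ ≥ 0. -/

import Mathlib

open Finset Matrix

/-- Total variation distance between two functions (distributions) on a finite set. -/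
noncomputable def tvDist {S : Type*} [Fintype S] (μ ν : S → ℝ) : ℝ :=
  (1 / 2) * ∑ x, |μ x - ν x|

/-- A probability distribution on a finite set. -/
def IsProbDist {S : Type*} [Fintype S] (μ : S → ℝ) : Prop :=
  (∀ x, 0 ≤ μ x) ∧ ∑ x, μ x = 1

/-- A (row-)stochastic matrix. -/
def IsStochastic {S : Type*} [Fintype S] (P : Matrix S S ℝ) : Prop :=
  (∀ x y, 0 ≤ P x y) ∧ ∀ x, ∑ y, P x y = 1

/-- Reversibility of `P` with respect to `π`. -/
def Reversible {S : Type*} [Fintype S] (P : Matrix S S ℝ) (π : S → ℝ) : Prop :=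
  ∀ x y, π x * P x y = π y * P y x

/-- `μ` is `(ε, T)`-metastable for `P`. -/
def IsMetastable {S : Type*} [Fintype S] [DecidableEq S]
    (P : Matrix S S ℝ) (μ : S → ℝ) (ε : ℝ) (T : ℕ) : Prop :=
  ∀ t : ℕ, t ≤ T → tvDist (μ ᵥ* (P ^ t)) μ ≤ ε

/-- The killed restriction `P_{\bar L}` of `P` to `L`, as a matrix on the full space. -/
noncomputable def Matrix.killed {S : Type*} [Fintype S] [DecidableEq S]
    (P : Matrix S S ℝ) (L : Finset S) : Matrix S S ℝ :=
  fun x y => if x ∈ L ∧ y ∈ L then P x y else 0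

/-- The restricted chain `P̊_L` on `L`. -/
noncomputable def restChain {S : Type*} [Fintype S] [DecidableEq S]
    (P : Matrix S S ℝ) (L : Finset S) : Matrix L L ℝ :=
  fun x y => if (x : S) = (y : S) then P (x : S) (x : S) + ∑ z ∈ Lᶜ, P (x : S) z
             else P (x : S) (y : S)

/-- The bottleneck ratio `B(L)` of `L` with respect to `P` and `π`. -/
noncomputable def bottleneck {S : Type*} [Fintype S] [DecidableEq S]
    (P : Matrix S S ℝ) (π : S → ℝ) (L : Finset S) : ℝ :=
  (∑ x ∈ L, ∑ y ∈ Lᶜ, π x * P x y) / ∑ x ∈ L, π x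

/-- The Gibbs measure associated to a potential `Φ` at rationality level `β`. -/
noncomputable def gibbs {S : Type*} [Fintype S] (β : ℝ) (Φ : S → ℝ) (x : S) : ℝ :=
  Real.exp (-β * Φ x) / ∑ y, Real.exp (-β * Φ y)

/-- The logit update probability `σ_i(s | x_{−i})`. -/
noncomputable def logitσ {n : ℕ} {Sty : Fin n → Type*} [∀ i, Fintype (Sty i)]
    [∀ i, DecidableEq (Sty i)]
    (u : ∀ i : Fin n, (∀ j, Sty j) → ℝ) (β : ℝ) (i : Fin n)
    (x : ∀ j, Sty j) (s : Sty i) : ℝ :=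
  Real.exp (β * u i (Function.update x i s)) /
    ∑ z : Sty i, Real.exp (β * u i (Function.update x i z))

/-- The logit dynamics transition matrix for an `n`-player game with utilities `u`
at rationality level `β`. -/
noncomputable def logitP (n : ℕ) (Sty : Fin n → Type*) [∀ i, Fintype (Sty i)]
    [∀ i, DecidableEq (Sty i)]
    (u : ∀ i : Fin n, (∀ j, Sty j) → ℝ) (β : ℝ) :
    Matrix (∀ j, Sty j) (∀ j, Sty j) ℝ :=
  fun x y =>
    if x = y then (n : ℝ)⁻¹ * ∑ i, logitσ u β i x (x i)
    else if (Finset.univ.filter fun i => x i ≠ y i).card = 1 then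
      (n : ℝ)⁻¹ * ∑ i ∈ Finset.univ.filter fun i => x i ≠ y i, logitσ u β i x (y i)
    else 0

/-- The logit dynamics transition matrix for an `n`-player potential game with
potential `Φ` at rationality level `β` (i.e. `σ_i` uses `exp(−β·Φ)`). -/
noncomputable def logitPpot (n : ℕ) (Sty : Fin n → Type*) [∀ i, Fintype (Sty i)]
    [∀ i, DecidableEq (Sty i)]
    (Φ : (∀ j, Sty j) → ℝ) (β : ℝ) :
    Matrix (∀ j, Sty j) (∀ j, Sty j) ℝ :=
  logitP n Sty (fun _ x => -Φ x) β

/-- A reversible idempotent matrix is positive semidefinite for the weighted inner product. -/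
lemma Reversible.quadForm_nonneg_of_idempotent {S : Type*} [Fintype S] {Q : Matrix S S ℝ}
    {π : S → ℝ} (hrev : Reversible Q π) (hπ : ∀ x, 0 ≤ π x) (hQ : Q * Q = Q) (f : S → ℝ) :
    0 ≤ ∑ x, ∑ y, π x * Q x y * (f x * f y) := by
  have key : ∀ x y, π x * Q x y = ∑ z, π z * (Q z x * Q z y) := by
    intro x y
    conv_lhs => rw [← hQ, Matrix.mul_apply, Finset.mul_sum]
    refine Finset.sum_congr rfl fun z _ => ?_
    rw [← mul_assoc, hrev x z, mul_assoc]
  have hsq : ∑ x, ∑ y, π x * Q x y * (f x * f y) = ∑ z, π z * (∑ x, Q z x * f x) ^ 2 := by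
    simp_rw [key, sq, Finset.sum_mul_sum, Finset.mul_sum, Finset.sum_mul]
    rw [Finset.sum_comm (γ := S) (s := Finset.univ) (t := Finset.univ)
      (f := fun z x => ∑ y, π z * (Q z x * f x * (Q z y * f y)))]
    refine Finset.sum_congr rfl fun x _ => ?_
    rw [Finset.sum_comm]
    exact Finset.sum_congr rfl fun z _ => Finset.sum_congr rfl fun y _ => by ring
  rw [hsq]
  exact Finset.sum_nonneg fun z _ => mul_nonneg (hπ z) (sq_nonneg _)

/-- The transition matrix of the logit dynamics in which player `i` is always selected. -/
noncomputable def logitUpdate {n : ℕ} {Sty : Fin n → Type*} [∀ i, Fintype (Sty i)]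
    [∀ i, DecidableEq (Sty i)] (u : ∀ i : Fin n, (∀ j, Sty j) → ℝ) (β : ℝ) (i : Fin n) :
    Matrix (∀ j, Sty j) (∀ j, Sty j) ℝ :=
  fun x y => ∑ s, if y = Function.update x i s then logitσ u β i x s else 0

lemma filter_ne_update {n : ℕ} {Sty : Fin n → Type*} [∀ i, DecidableEq (Sty i)] (i : Fin n)
    {x : ∀ j, Sty j} {s : Sty i}
    (h : x ≠ Function.update x i s) :
    (Finset.univ.filter fun j => x j ≠ Function.update x i s j) = {i} := by
  have hs : x i ≠ s := fun hs => h (by simp [← hs])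
  ext j
  by_cases hj : j = i
  · subst hj; simpa using hs
  · simp [hj]

section LogitUpdate

variable {n : ℕ} {Sty : Fin n → Type*} [∀ i, Fintype (Sty i)] [∀ i, DecidableEq (Sty i)]
  (u : ∀ i : Fin n, (∀ j, Sty j) → ℝ) (β : ℝ) (i : Fin n)

lemma logitσ_update (x : ∀ j, Sty j) (s t : Sty i) :
    logitσ u β i (Function.update x i s) t = logitσ u β i x t := by
  simp [logitσ]

lemma sum_logitσ [∀ i, Nonempty (Sty i)] (x : ∀ j, Sty j) : ∑ s, logitσ u β i x s = 1 := by
  unfold logitσ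
  rw [← Finset.sum_div]
  exact div_self (Finset.sum_pos (fun _ _ => Real.exp_pos _) Finset.univ_nonempty).ne'

lemma logitUpdate_update_left (x y : ∀ j, Sty j) (s : Sty i) :
    logitUpdate u β i (Function.update x i s) y = logitUpdate u β i x y := by
  simp [logitUpdate, logitσ_update]

lemma logitUpdate_apply_update (x : ∀ j, Sty j) (s : Sty i) :
    logitUpdate u β i x (Function.update x i s) = logitσ u β i x s := by
  simp [logitUpdate, (Function.update_injective x i).eq_iff]

lemma logitUpdate_apply_self (x : ∀ j, Sty j) :
    logitUpdate u β i x x = logitσ u β i x (x i) := by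
  simpa using logitUpdate_apply_update u β i x (x i)

lemma logitUpdate_of_forall_ne {x y : ∀ j, Sty j} (h : ∀ s, y ≠ Function.update x i s) :
    logitUpdate u β i x y = 0 := by
  simp [logitUpdate, h]

lemma logitUpdate_mul_self [∀ i, Nonempty (Sty i)] :
    logitUpdate u β i * logitUpdate u β i = logitUpdate u β i := by
  ext x z
  have h : ∀ y, logitUpdate u β i x y * logitUpdate u β i y z =
      ∑ s, if y = Function.update x i s then
        logitσ u β i x s * logitUpdate u β i x z else 0 := by
    intro y
    conv_lhs => rw [logitUpdate, Finset.sum_mul]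
    refine Finset.sum_congr rfl fun s _ => ?_
    split_ifs with hy
    · rw [hy, logitUpdate_update_left]
    · exact zero_mul _
  rw [Matrix.mul_apply]
  simp_rw [h]
  rw [Finset.sum_comm]
  simp [← Finset.sum_mul, sum_logitσ]

lemma logitP_apply_update {x : ∀ j, Sty j} {s : Sty i} (h : x ≠ Function.update x i s) :
    logitP n Sty u β x (Function.update x i s) =
      (n : ℝ)⁻¹ * logitUpdate u β i x (Function.update x i s) := by
  simp only [logitP, if_neg h, filter_ne_update i h]
  simp [logitUpdate_apply_update]

lemma logitP_apply (x y : ∀ j, Sty j) :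
    logitP n Sty u β x y = (n : ℝ)⁻¹ * ∑ i, logitUpdate u β i x y := by
  by_cases hxy : x = y
  · subst hxy
    simp [logitP, logitUpdate_apply_self]
  by_cases h : ∃ i s, y = Function.update x i s
  · obtain ⟨i, s, rfl⟩ := h
    rw [logitP_apply_update u β i hxy, Finset.sum_eq_single i]
    · intro j _ hj
      refine logitUpdate_of_forall_ne u β j fun t ht => hxy ?_
      have hi := congrFun ht i
      simp only [Function.update_self, Function.update_of_ne hj.symm] at hi
      simp [hi]
    · simp
  · push Not at h
    have hcard : (Finset.univ.filter fun i => x i ≠ y i).card ≠ 1 := by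
      rw [Ne, Finset.card_eq_one]
      rintro ⟨i, hi⟩
      refine h i (y i) (funext fun j => ?_)
      by_cases hj : j = i
      · subst hj; simp
      · have hmem : j ∉ Finset.univ.filter fun i => x i ≠ y i := by simp [hi, hj]
        simpa [hj, eq_comm] using hmem
    simp [logitP, hxy, hcard, logitUpdate_of_forall_ne u β _ (h _)]

variable {u β} in
lemma Reversible.logitUpdate_of_logitP {π : (∀ j, Sty j) → ℝ}
    (hrev : Reversible (logitP n Sty u β) π) : Reversible (logitUpdate u β i) π := by
  intro x y
  by_cases hxy : x = y
  · rw [hxy]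
  by_cases h : ∃ s, y = Function.update x i s
  · obtain ⟨s, rfl⟩ := h
    have hn : (n : ℝ) ≠ 0 := by exact_mod_cast (Fin.pos i).ne'
    have hx : Function.update (Function.update x i s) i (x i) = x := by simp
    have hback := logitP_apply_update u β i (x := Function.update x i s) (s := x i)
      (by rw [hx]; exact Ne.symm hxy)
    rw [hx] at hback
    have hr := hrev x (Function.update x i s)
    rw [logitP_apply_update u β i hxy, hback] at hr
    field_simp at hr
    exact hr
  · have h' : ∀ s, x ≠ Function.update y i s := by
      rintro s hs
      exact h ⟨y i, by rw [hs]; simp⟩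
    push Not at h
    rw [logitUpdate_of_forall_ne u β i h, logitUpdate_of_forall_ne u β i h']
    simp

variable {u β} in
lemma Reversible.quadForm_logitP_nonneg [∀ i, Nonempty (Sty i)] {π : (∀ j, Sty j) → ℝ}
    (hrev : Reversible (logitP n Sty u β) π) (hπ : ∀ x, 0 ≤ π x) (f : (∀ j, Sty j) → ℝ) :
    0 ≤ ∑ x, ∑ y, π x * logitP n Sty u β x y * (f x * f y) := by
  have h : ∑ x, ∑ y, π x * logitP n Sty u β x y * (f x * f y) =
      (n : ℝ)⁻¹ * ∑ i, ∑ x, ∑ y, π x * logitUpdate u β i x y * (f x * f y) := by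
    rw [Finset.sum_comm (s := (Finset.univ : Finset (Fin n))), Finset.mul_sum]
    refine Finset.sum_congr rfl fun x _ => ?_
    rw [Finset.sum_comm, Finset.mul_sum]
    refine Finset.sum_congr rfl fun y _ => ?_
    rw [logitP_apply, ← Finset.sum_mul, ← Finset.mul_sum]
    ring
  rw [h]
  exact mul_nonneg (by positivity) (Finset.sum_nonneg fun i _ =>
    (hrev.logitUpdate_of_logitP i).quadForm_nonneg_of_idempotent hπ (logitUpdate_mul_self u β i) f)

end LogitUpdate

/-- Every nice restriction of the (reversible) logit dynamics transition matrix has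
nonnegative real eigenvalues. -/
theorem nice_restriction_nonneg_spectrum (n : ℕ) (hn : 1 ≤ n)
    (Sty : Fin n → Type*) [∀ i, Fintype (Sty i)] [∀ i, DecidableEq (Sty i)]
    [∀ i, Nonempty (Sty i)]
    (u : ∀ i : Fin n, (∀ j, Sty j) → ℝ) (β : ℝ) (hβ : 0 ≤ β)
    (π : (∀ j, Sty j) → ℝ) (hπ : IsProbDist π) (hpos : ∀ x, 0 < π x)
    (hrev : Reversible (logitP n Sty u β) π)
    (L : Finset (∀ j, Sty j)) (hL : L.Nonempty)
    (P' : Matrix (∀ j, Sty j) (∀ j, Sty j) ℝ)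
    (hoff : ∀ x ∈ L, ∀ y ∈ L, x ≠ y → P' x y = logitP n Sty u β x y)
    (hdiag : ∀ x ∈ L, logitP n Sty u β x x ≤ P' x x)
    (hout : ∀ x y, (x ∉ L ∨ y ∉ L) → P' x y = 0) :
    ∀ μ ∈ spectrum ℝ P', 0 ≤ μ := by
  intro μ hμ
  by_contra! hneg
  rw [← Matrix.spectrum_toLin', ← Module.End.hasEigenvalue_iff_mem_spectrum] at hμ
  obtain ⟨v, hv⟩ := hμ.exists_hasEigenvector
  have heig : ∀ x, ∑ y, P' x y * v y = μ * v x := fun x => by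
    simpa [Matrix.mulVec, dotProduct] using congrFun hv.apply_eq_smul x
  have hsupp : ∀ x ∉ L, v x = 0 := fun x hx => by
    have h := heig x
    simp_rw [hout x _ (Or.inl hx), zero_mul, Finset.sum_const_zero] at h
    exact (mul_eq_zero.mp h.symm).resolve_left hneg.ne
  have hle : ∑ x, ∑ y, π x * logitP n Sty u β x y * (v x * v y) ≤
      ∑ x, ∑ y, π x * P' x y * (v x * v y) := by
    refine Finset.sum_le_sum fun x _ => Finset.sum_le_sum fun y _ => ?_
    by_cases hx : x ∈ L
    · by_cases hy : y ∈ L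
      · by_cases hxy : x = y
        · subst hxy
          exact mul_le_mul_of_nonneg_right
            (mul_le_mul_of_nonneg_left (hdiag x hx) (hpos x).le) (mul_self_nonneg _)
        · rw [hoff x hx y hy hxy]
      · simp [hsupp y hy]
    · simp [hsupp x hx]
  have hform : ∑ x, ∑ y, π x * P' x y * (v x * v y) = μ * ∑ x, π x * v x ^ 2 := by
    rw [Finset.mul_sum]
    refine Finset.sum_congr rfl fun x _ => ?_
    calc ∑ y, π x * P' x y * (v x * v y) = π x * v x * ∑ y, P' x y * v y := by
          rw [Finset.mul_sum]
          exact Finset.sum_congr rfl fun y _ => by ring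
      _ = μ * (π x * v x ^ 2) := by rw [heig]; ring
  have hnorm : 0 < ∑ x, π x * v x ^ 2 := by
    obtain ⟨x, hx⟩ := Function.ne_iff.mp hv.2
    have hx' : v x ≠ 0 := hx
    exact Finset.sum_pos' (fun y _ => mul_nonneg (hpos y).le (sq_nonneg _))
      ⟨x, Finset.mem_univ x, mul_pos (hpos x) (by positivity)⟩
  have hnonneg := hrev.quadForm_logitP_nonneg (fun x => (hpos x).le) v
  have := mul_neg_of_neg_of_pos hneg hnorm
  linarith
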